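/- The kernel of Ω is the principal ideal of K[T0,T1,Z_0,Z_1,Z_2] generated by P = p_0·Z_0 + p_1·Z_1 + p_2·Z_2. -/

import Mathlib

open MvPolynomial

noncomputable section

/-- The polynomial ring `K[T0,T1]`. -/
abbrev PT (K : Type) [Field K] := MvPolynomial (Fin 2) K

/-- The polynomial ring `K[T0,T1,X,Y]`; `Sum.inr 0 = X`, `Sum.inr 1 = Y`. -/
abbrev PTXY (K : Type) [Field K] := MvPolynomial (Fin 2 ⊕ Fin 2) K

/-- The polynomial ring `K[T0,T1,Z_0,Z_1,Z_2]`. -/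
abbrev PTZ (K : Type) [Field K] := MvPolynomial (Fin 2 ⊕ Fin 3) K

/-- The map `Ω : K[T0,T1,Z_0,Z_1,Z_2] → K[T0,T1,X,Y]` with `Z_i ↦ A_i·X + B_i·Y`. -/
def OmegaMap (K : Type) [Field K] (A B : Fin 3 → PT K) : PTZ K →ₐ[K] PTXY K :=
  aeval (Sum.elim (fun i => X (Sum.inl i))
    (fun i => rename Sum.inl (A i) * X (Sum.inr 0) + rename Sum.inl (B i) * X (Sum.inr 1)))

/-- The cross product `p = A × B`. -/
def crossProd (K : Type) [Field K] (A B : Fin 3 → PT K) : Fin 3 → PT K :=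
  ![A 1 * B 2 - A 2 * B 1, A 2 * B 0 - A 0 * B 2, A 0 * B 1 - A 1 * B 0]

/-- `K[T0,T1,Z_0,Z_1,Z_2]` as a polynomial ring in the `Z_i` over `K[T0,T1]`. -/
def ptzEquiv (K : Type) [Field K] : PTZ K ≃ₐ[K] MvPolynomial (Fin 3) (PT K) :=
  (renameEquiv K (Equiv.sumComm (Fin 2) (Fin 3))).trans (sumAlgEquiv K (Fin 3) (Fin 2))

lemma ptzEquiv_rename_inl {K : Type} [Field K] (f : PT K) :
    ptzEquiv K (rename Sum.inl f) = C f := by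
  have h : ((ptzEquiv K : PTZ K →ₐ[K] MvPolynomial (Fin 3) (PT K)).comp (rename Sum.inl)) =
      IsScalarTower.toAlgHom K (PT K) (MvPolynomial (Fin 3) (PT K)) := by
    ext i
    simp [ptzEquiv]
  exact DFunLike.congr_fun h f

lemma ptzEquiv_X_inr {K : Type} [Field K] (i : Fin 3) :
    ptzEquiv K (X (Sum.inr i)) = X i := by
  simp [ptzEquiv]

lemma irreducible_sum_rename_mul_X {K : Type} [Field K] (p : Fin 3 → PT K)
    (hp0 : ∃ i, p i ≠ 0) (hpcop : ∀ c : PT K, (∀ i, c ∣ p i) → IsUnit c) :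
    Irreducible (∑ i : Fin 3, (rename Sum.inl (p i) : PTZ K) * X (Sum.inr i)) := by
  have h := irreducible_sumSMulX (Finsupp.equivFunOnFinite.symm p)
    (by
      obtain ⟨i, hi⟩ := hp0
      exact ⟨i, by simpa using hi⟩)
    (by simpa using hpcop)
  refine .of_map (f := ptzEquiv K) ?_
  convert h using 1
  simp only [map_sum, map_mul, ptzEquiv_rename_inl, ptzEquiv_X_inr, sumSMulX]
  rw [Finsupp.linearCombination_apply, Finsupp.sum_fintype _ _ (by simp)]
  simp [smul_eq_C_mul]

lemma OmegaMap_rename_inl {K : Type} [Field K] (A B : Fin 3 → PT K) (f : PT K) :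
    OmegaMap K A B (rename Sum.inl f) = rename Sum.inl f := by
  rw [OmegaMap, aeval_rename, Sum.elim_comp_inl]
  exact DFunLike.congr_fun (by ext i; simp : aeval (R := K) (fun i => X (Sum.inl i)) =
    (rename Sum.inl : PT K →ₐ[K] PTXY K)) f

lemma OmegaMap_X_inr {K : Type} [Field K] (A B : Fin 3 → PT K) (i : Fin 3) :
    OmegaMap K A B (X (Sum.inr i)) =
      rename Sum.inl (A i) * X (Sum.inr 0) + rename Sum.inl (B i) * X (Sum.inr 1) := by
  simp [OmegaMap]

/-- Solving the equations `Z_i = A_i X + B_i Y`, `Z_j = A_j X + B_j Y` by Cramer's rule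
inverts `Ω` over any field in which `∑ p_i Z_i = 0` and the minor is nonzero. -/
lemma eq_zero_of_OmegaMap_eq_zero {K : Type} [Field K] {A B : Fin 3 → PT K}
    {L : Type} [Field L] [Algebra K L] (φ : PTZ K →ₐ[K] L)
    (hφ : φ (∑ i : Fin 3, (rename Sum.inl (crossProd K A B i) : PTZ K) * X (Sum.inr i)) = 0)
    {k : Fin 3} (hk : φ (rename Sum.inl (crossProd K A B k)) ≠ 0)
    {F : PTZ K} (hF : OmegaMap K A B F = 0) : φ F = 0 := by
  set a : Fin 3 → L := fun i => φ (rename Sum.inl (A i)) with ha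
  set b : Fin 3 → L := fun i => φ (rename Sum.inl (B i)) with hb
  set z : Fin 3 → L := fun i => φ (X (Sum.inr i)) with hz
  have hP : (a 1 * b 2 - a 2 * b 1) * z 0 + (a 2 * b 0 - a 0 * b 2) * z 1 +
      (a 0 * b 1 - a 1 * b 0) * z 2 = 0 := by
    simpa [Fin.sum_univ_three, crossProd, ha, hb, hz] using hφ
  obtain ⟨x, y, hxy⟩ : ∃ x y : L, ∀ i, a i * x + b i * y = z i := by
    have key : ∀ i j : Fin 3, a i * b j - a j * b i ≠ 0 →
        (∀ l, (a i * b j - a j * b i) * z l =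
          a l * (b j * z i - b i * z j) + b l * (a i * z j - a j * z i)) →
        ∃ x y : L, ∀ i, a i * x + b i * y = z i := by
      intro i j hd h
      refine ⟨(b j * z i - b i * z j) / (a i * b j - a j * b i),
        (a i * z j - a j * z i) / (a i * b j - a j * b i), fun l => ?_⟩
      rw [mul_div_assoc', mul_div_assoc', ← add_div, ← h, mul_div_cancel_left₀ _ hd]
    fin_cases k
    · refine key 1 2 (by simpa [crossProd, ha, hb] using hk) fun l => ?_
      fin_cases l <;> simp only [Fin.zero_eta, Fin.mk_one, Fin.reduceFinMk] <;>
        grind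
    · refine key 2 0 (by simpa [crossProd, ha, hb] using hk) fun l => ?_
      fin_cases l <;> simp only [Fin.zero_eta, Fin.mk_one, Fin.reduceFinMk] <;> grind
    · refine key 0 1 (by simpa [crossProd, ha, hb] using hk) fun l => ?_
      fin_cases l <;> simp only [Fin.zero_eta, Fin.mk_one, Fin.reduceFinMk] <;> grind
  let ψ : PTXY K →ₐ[K] L := aeval (Sum.elim (fun i => φ (X (Sum.inl i))) ![x, y])
  have hψ (f : PT K) : ψ (rename Sum.inl f) = φ (rename Sum.inl f) := by
    have h : ψ.comp (rename Sum.inl) = φ.comp (rename Sum.inl) := by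
      ext i
      simp [ψ]
    exact DFunLike.congr_fun h f
  have hcomp : ψ.comp (OmegaMap K A B) = φ := by
    ext (i | i)
    · simp [OmegaMap, ψ]
    · have h := hxy i
      simp only [ha, hb, hz] at h
      simp only [AlgHom.comp_apply, OmegaMap_X_inr, map_add, map_mul, hψ]
      simpa [ψ] using h
  rw [← hcomp, AlgHom.comp_apply, hF, map_zero]

lemma rename_inl_notMem_span {K : Type} [Field K] (p : Fin 3 → PT K) {f : PT K} (hf : f ≠ 0) :
    (rename Sum.inl f : PTZ K) ∉
      Ideal.span {∑ i : Fin 3, (rename Sum.inl (p i) : PTZ K) * X (Sum.inr i)} := by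
  rw [Ideal.mem_span_singleton]
  rintro ⟨g, hg⟩
  let ε : PTZ K →ₐ[K] PT K := aeval (Sum.elim X 0)
  have h : ε (rename Sum.inl f) = f := by
    rw [aeval_rename, Sum.elim_comp_inl, aeval_X_left_apply]
  apply hf
  rw [← h, hg]
  simp [ε, map_sum]

theorem stmt10 (K : Type) [Field K] (μ1 μ2 : ℕ) (hμ12 : μ1 ≤ μ2)
    (A B : Fin 3 → PT K)
    (hAhom : ∀ i, (A i).IsHomogeneous μ1) (hBhom : ∀ i, (B i).IsHomogeneous μ2)
    (hp0 : ¬ (∀ i, crossProd K A B i = 0))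
    (hpcop : ∀ c : PT K, (∀ i, c ∣ crossProd K A B i) → IsUnit c) :
    RingHom.ker (OmegaMap K A B) =
      Ideal.span {∑ i : Fin 3, (rename Sum.inl (crossProd K A B i) : PTZ K) * X (Sum.inr i)} := by
  have hp0' : ∃ i, crossProd K A B i ≠ 0 := not_forall.mp hp0
  set P : PTZ K := ∑ i : Fin 3, (rename Sum.inl (crossProd K A B i) : PTZ K) * X (Sum.inr i)
    with hPdef
  have hirr : Irreducible P := irreducible_sum_rename_mul_X _ hp0' hpcop
  have hprime : (Ideal.span {P}).IsPrime :=
    (Ideal.span_singleton_prime hirr.ne_zero).mpr hirr.prime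
  obtain ⟨k, hk⟩ := hp0'
  apply le_antisymm
  · intro F hF
    let φ : PTZ K →ₐ[K] FractionRing (PTZ K ⧸ Ideal.span {P}) :=
      (IsScalarTower.toAlgHom K (PTZ K ⧸ Ideal.span {P}) _).comp (Ideal.Quotient.mkₐ K _)
    have hφ (G : PTZ K) : φ G = 0 ↔ G ∈ Ideal.span {P} := by
      simp [φ, Ideal.Quotient.eq_zero_iff_mem]
    rw [← hφ]
    refine eq_zero_of_OmegaMap_eq_zero (k := k) φ
      ((hφ P).mpr (Ideal.mem_span_singleton_self P)) ?_ hF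
    exact fun h => rename_inl_notMem_span _ hk ((hφ _).mp h)
  · rw [Ideal.span_singleton_le_iff_mem, RingHom.mem_ker, hPdef]
    simp only [map_sum, map_mul, OmegaMap_rename_inl, OmegaMap_X_inr]
    simp only [Fin.sum_univ_three, crossProd, Matrix.cons_val, map_sub, map_mul]
    ring
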